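/- (Local stability of generalized minima.) Let the dataset contain at least K distinct points, the communication graph be connected, and the step size satisfy 0 < α < d_min/((1/ρ)N* + λ_M(L)). Let (x_t) be generated by the NK-means algorithm and let x̆ be a generalized Lloyd's minimum of J^ρ. Then there exists ε̄_x̆ > 0 such that for each ε ∈ (0, ε̄_x̆) there exists a time t_ε with the following property: if ‖x_{t'} − x̆‖_∞ ≤ ε for some t' ≥ t_ε, then ‖x_t − x̆‖_∞ ≤ ε for all t ≥ t'. -/

import Mathlib

open scoped BigOperators

noncomputable section

/-! ### Basic (centralized) K-means notions -/

/-- The dataset `D` contains at least `K` distinct points. -/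
def HasKDistinct {p : ℕ} (K : ℕ) (D : Multiset (EuclideanSpace ℝ (Fin p))) : Prop :=
  ∃ S : Finset (EuclideanSpace ℝ (Fin p)), S.card = K ∧ ∀ y ∈ S, y ∈ D

/-- The K-means clustering cost `F(x) = ∑_{y ∈ D} min_k ‖y - x^k‖²`. -/
def kmeansF {p : ℕ} (K : ℕ) (D : Multiset (EuclideanSpace ℝ (Fin p)))
    (x : Fin K → EuclideanSpace ℝ (Fin p)) : ℝ :=
  (D.map fun y => ⨅ k : Fin K, ‖y - x k‖ ^ 2).sum

/-- `P` is a partition of the multiset `D` into `K` (possibly empty) cells. -/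
def IsKPartition {p K : ℕ} (D : Multiset (EuclideanSpace ℝ (Fin p)))
    (P : Fin K → Multiset (EuclideanSpace ℝ (Fin p))) : Prop :=
  ∑ k, P k = D

/-- The distortion cost `H(x, P) = ∑_k ∑_{y ∈ P^k} ‖y - x^k‖²`. -/
def costH {p K : ℕ} (x : Fin K → EuclideanSpace ℝ (Fin p))
    (P : Fin K → Multiset (EuclideanSpace ℝ (Fin p))) : ℝ :=
  ∑ k, ((P k).map fun y => ‖y - x k‖ ^ 2).sum

/-- `(x, P)` is a Lloyd's minimum for the dataset `D`. -/
def IsLloydMin {p K : ℕ} (D : Multiset (EuclideanSpace ℝ (Fin p)))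
    (x : Fin K → EuclideanSpace ℝ (Fin p))
    (P : Fin K → Multiset (EuclideanSpace ℝ (Fin p))) : Prop :=
  IsKPartition D P ∧
    (∀ Q, IsKPartition D Q → costH x P ≤ costH x Q) ∧
    (∀ x', costH x P ≤ costH x' P)

/-- The set `Z` of Lloyd's minima (cluster-center tuples). -/
def LloydZ {p : ℕ} (K : ℕ) (D : Multiset (EuclideanSpace ℝ (Fin p))) :
    Set (Fin K → EuclideanSpace ℝ (Fin p)) :=
  {x | ∃ P, IsLloydMin D x P}

/-- The set `Z̄` of Lloyd's minima whose centers lie in the (closed) convex hull of `D`. -/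
def LloydZbar {p : ℕ} (K : ℕ) (D : Multiset (EuclideanSpace ℝ (Fin p))) :
    Set (Fin K → EuclideanSpace ℝ (Fin p)) :=
  {x ∈ LloydZ K D | ∀ k, x k ∈ convexHull ℝ {y | y ∈ D}}

/-- The set `Z_g` of global minimizers of the K-means cost `F`. -/
def kmeansZg {p : ℕ} (K : ℕ) (D : Multiset (EuclideanSpace ℝ (Fin p))) :
    Set (Fin K → EuclideanSpace ℝ (Fin p)) :=
  {x | ∀ x', kmeansF K D x ≤ kmeansF K D x'}

/-- The global minimum value `F*` of the K-means cost. -/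
def Fstar {p : ℕ} (K : ℕ) (D : Multiset (EuclideanSpace ℝ (Fin p))) : ℝ :=
  sInf (Set.range (kmeansF K D))

/-- `R₀ = max{‖v‖ : v ∈ closed convex hull of D}`. -/
def R0 {p : ℕ} (D : Multiset (EuclideanSpace ℝ (Fin p))) : ℝ :=
  sSup ((fun v => ‖v‖) '' convexHull ℝ {y | y ∈ D})

/-! ### Multi-agent notions -/

section Distributed

variable {p K M : ℕ}

/-- The multi-agent cost `J^ρ(x, C)`; each undirected edge is counted once in the
agreement term. -/
def costJ (ρ : ℝ) (G : SimpleGraph (Fin M)) [DecidableRel G.Adj]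
    (x : Fin M → Fin K → EuclideanSpace ℝ (Fin p))
    (C : Fin M → Fin K → Multiset (EuclideanSpace ℝ (Fin p))) : ℝ :=
  (1 / ρ) * ∑ m, ∑ k, ((C m k).map fun y => ‖y - x m k‖ ^ 2).sum +
    (1 / 2) * ∑ m, ∑ l ∈ G.neighborFinset m, ∑ k, ‖x m k - x l k‖ ^ 2

/-- The multi-agent cost `Q^ρ(x)`. -/
def costQ (ρ : ℝ) (G : SimpleGraph (Fin M)) [DecidableRel G.Adj]
    (Dm : Fin M → Multiset (EuclideanSpace ℝ (Fin p)))
    (x : Fin M → Fin K → EuclideanSpace ℝ (Fin p)) : ℝ :=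
  (1 / ρ) * ∑ m, ((Dm m).map fun y => ⨅ k : Fin K, ‖y - x m k‖ ^ 2).sum +
    (1 / 2) * ∑ m, ∑ l ∈ G.neighborFinset m, ∑ k, ‖x m k - x l k‖ ^ 2

/-- The set of global minimizers `M^ρ_g` of `Q^ρ`. -/
def globQ (ρ : ℝ) (G : SimpleGraph (Fin M)) [DecidableRel G.Adj]
    (Dm : Fin M → Multiset (EuclideanSpace ℝ (Fin p))) (K : ℕ) :
    Set (Fin M → Fin K → EuclideanSpace ℝ (Fin p)) :=
  {x | ∀ x' : Fin M → Fin K → EuclideanSpace ℝ (Fin p), costQ ρ G Dm x ≤ costQ ρ G Dm x'}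

/-- `C ∈ U_x` : `C` is an admissible (Voronoi / nearest-center) clustering for `x`. -/
def InVoronoi (Dm : Fin M → Multiset (EuclideanSpace ℝ (Fin p)))
    (x : Fin M → Fin K → EuclideanSpace ℝ (Fin p))
    (C : Fin M → Fin K → Multiset (EuclideanSpace ℝ (Fin p))) : Prop :=
  (∀ m, IsKPartition (Dm m) (C m)) ∧
    ∀ m k y, y ∈ C m k → ∀ k', ‖y - x m k‖ ≤ ‖y - x m k'‖

/-- The fixed-point (stationarity) equations
`((1/ρ)|C_m^k| + |Ω_m|) x_m^k = (1/ρ) ∑_{y ∈ C_m^k} y + ∑_{l ∈ Ω_m} x_l^k`. -/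
def IsFixedCenters (ρ : ℝ) (G : SimpleGraph (Fin M)) [DecidableRel G.Adj]
    (x : Fin M → Fin K → EuclideanSpace ℝ (Fin p))
    (C : Fin M → Fin K → Multiset (EuclideanSpace ℝ (Fin p))) : Prop :=
  ∀ m k, ((1 / ρ) * ((C m k).card : ℝ) + (G.degree m : ℝ)) • x m k =
      (1 / ρ) • (C m k).sum + ∑ l ∈ G.neighborFinset m, x l k

/-- `(x, C)` is a generalized Lloyd's minimum of `J^ρ`. -/
def IsGenLloydMin (ρ : ℝ) (G : SimpleGraph (Fin M)) [DecidableRel G.Adj]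
    (Dm : Fin M → Multiset (EuclideanSpace ℝ (Fin p)))
    (x : Fin M → Fin K → EuclideanSpace ℝ (Fin p))
    (C : Fin M → Fin K → Multiset (EuclideanSpace ℝ (Fin p))) : Prop :=
  InVoronoi Dm x C ∧ IsFixedCenters ρ G x C

/-- The set `M^ρ` of generalized Lloyd's minima (centers part). -/
def genM (ρ : ℝ) (G : SimpleGraph (Fin M)) [DecidableRel G.Adj]
    (Dm : Fin M → Multiset (EuclideanSpace ℝ (Fin p))) (K : ℕ) :
    Set (Fin M → Fin K → EuclideanSpace ℝ (Fin p)) :=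
  {x | ∃ C, IsGenLloydMin ρ G Dm x C}

/-- The set `M̄^ρ` of generalized Lloyd's minima with all centers in the (closed)
convex hull of the collective dataset `D`. -/
def genMbar (ρ : ℝ) (G : SimpleGraph (Fin M)) [DecidableRel G.Adj]
    (Dm : Fin M → Multiset (EuclideanSpace ℝ (Fin p)))
    (D : Multiset (EuclideanSpace ℝ (Fin p))) (K : ℕ) :
    Set (Fin M → Fin K → EuclideanSpace ℝ (Fin p)) :=
  {x ∈ genM ρ G Dm K | ∀ m k, x m k ∈ convexHull ℝ {y | y ∈ D}}

/-- The update target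
`μ_m^k = ((1/ρ) ∑_{y ∈ C_m^k} y + ∑_{l ∈ Ω_m} x_l^k) / ((1/ρ)|C_m^k| + |Ω_m|)`. -/
def muVec (ρ : ℝ) (G : SimpleGraph (Fin M)) [DecidableRel G.Adj]
    (x : Fin M → Fin K → EuclideanSpace ℝ (Fin p))
    (C : Fin M → Fin K → Multiset (EuclideanSpace ℝ (Fin p)))
    (m : Fin M) (k : Fin K) : EuclideanSpace ℝ (Fin p) :=
  ((1 / ρ) * ((C m k).card : ℝ) + (G.degree m : ℝ))⁻¹ •
    ((1 / ρ) • (C m k).sum + ∑ l ∈ G.neighborFinset m, x l k)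

/-- `(x_t, C_t)` is a trajectory of the NK-means algorithm with parameters `ρ, α`. -/
def NKMeansSeq (ρ α : ℝ) (G : SimpleGraph (Fin M)) [DecidableRel G.Adj]
    (Dm : Fin M → Multiset (EuclideanSpace ℝ (Fin p)))
    (x : ℕ → Fin M → Fin K → EuclideanSpace ℝ (Fin p))
    (C : ℕ → Fin M → Fin K → Multiset (EuclideanSpace ℝ (Fin p))) : Prop :=
  (∀ m, IsKPartition (Dm m) (C 0 m)) ∧
    ∀ t, (∀ m, IsKPartition (Dm m) (C (t + 1) m)) ∧
      (∀ m k y, y ∈ C (t + 1) m k → ∀ k', ‖y - x t m k‖ ≤ ‖y - x t m k'‖) ∧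
      ∀ m k, x (t + 1) m k = x t m k - α • (x t m k - muVec ρ G (x t) (C (t + 1)) m k)

/-- The minimum vertex degree `d_min` of the communication graph. -/
def minDeg (G : SimpleGraph (Fin M)) [DecidableRel G.Adj] : ℕ :=
  sInf (Set.range fun m : Fin M => G.degree m)

/-- The largest eigenvalue `λ_M(L)` of the graph Laplacian. -/
def lapLamMax (G : SimpleGraph (Fin M)) [DecidableRel G.Adj] : ℝ :=
  sSup (spectrum ℝ (G.lapMatrix ℝ))

/-- The second-smallest eigenvalue `λ₂(L)` of the graph Laplacian (for a connected
graph, the smallest nonzero eigenvalue). -/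
def lapLam2 (G : SimpleGraph (Fin M)) [DecidableRel G.Adj] : ℝ :=
  sInf {μ : ℝ | μ ∈ spectrum ℝ (G.lapMatrix ℝ) ∧ μ ≠ 0}

/-- `N* = max_m |D_m|`. -/
def Nstar (Dm : Fin M → Multiset (EuclideanSpace ℝ (Fin p))) : ℕ :=
  Finset.univ.sup fun m => (Dm m).card

/-- The step-size condition `0 < α < d_min / ((1/ρ) N* + λ_M(L))`. -/
def StepOK (ρ α : ℝ) (G : SimpleGraph (Fin M)) [DecidableRel G.Adj]
    (Dm : Fin M → Multiset (EuclideanSpace ℝ (Fin p))) : Prop :=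
  0 < α ∧ α * ((1 / ρ) * (Nstar Dm : ℝ) + lapLamMax G) < (minDeg G : ℝ)

/-- The constant `c(α) = 2α(d_min − α((1/ρ)N* + λ_M(L)))`. -/
def cAlpha (ρ α : ℝ) (G : SimpleGraph (Fin M)) [DecidableRel G.Adj]
    (Dm : Fin M → Multiset (EuclideanSpace ℝ (Fin p))) : ℝ :=
  2 * α * ((minDeg G : ℝ) - α * ((1 / ρ) * (Nstar Dm : ℝ) + lapLamMax G))

end Distributed

section

variable {V E : Type*} [Fintype V] (G : SimpleGraph V) [DecidableRel G.Adj]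

/-- A double sum over adjacent ordered pairs is symmetric. -/
theorem sum_neighborFinset_swap {A : Type*} [AddCommMonoid A] (F : V → V → A) :
    ∑ m, ∑ l ∈ G.neighborFinset m, F m l = ∑ m, ∑ l ∈ G.neighborFinset m, F l m := by
  simp only [SimpleGraph.neighborFinset_eq_filter, Finset.sum_filter]
  rw [Finset.sum_comm]
  simp only [G.adj_comm]

section

variable [DecidableEq V]

theorem posSemidef_sSup_spectrum_smul_one_sub (A : Matrix V V ℝ) (hA : A.IsHermitian) :
    (sSup (spectrum ℝ A) • (1 : Matrix V V ℝ) - A).PosSemidef := by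
  rw [Matrix.posSemidef_iff_isHermitian_and_spectrum_nonneg]
  refine ⟨(Matrix.isHermitian_one.smul (IsSelfAdjoint.all _)).sub hA, ?_⟩
  rw [← Algebra.algebraMap_eq_smul_one, ← spectrum.singleton_sub_eq]
  rintro _ ⟨a, rfl, b, hb, rfl⟩
  have hbdd : BddAbove (spectrum ℝ A) := by
    rw [hA.spectrum_real_eq_range_eigenvalues]
    exact (Set.finite_range _).bddAbove
  have := le_csSup hbdd hb
  simpa using this

theorem degree_le_sSup_spectrum_lapMatrix (m : V) :
    (G.degree m : ℝ) ≤ sSup (spectrum ℝ (G.lapMatrix ℝ)) := by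
  have h := (posSemidef_sSup_spectrum_smul_one_sub _ (G.isHermitian_lapMatrix ℝ)).diag_nonneg
    (i := m)
  simpa [SimpleGraph.lapMatrix, SimpleGraph.degMatrix] using h

theorem sum_sq_sub_le_sSup_spectrum_lapMatrix (f : V → ℝ) :
    (1 / 2) * ∑ m, ∑ l ∈ G.neighborFinset m, (f m - f l) ^ 2 ≤
      sSup (spectrum ℝ (G.lapMatrix ℝ)) * ∑ m, f m ^ 2 := by
  have h := (posSemidef_sSup_spectrum_smul_one_sub _
    (G.isHermitian_lapMatrix ℝ)).dotProduct_mulVec_nonneg f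
  have h2 := G.lapMatrix_toLinearMap₂' ℝ f
  rw [Matrix.toLinearMap₂'_apply'] at h2
  rw [Matrix.sub_mulVec, dotProduct_sub, star_trivial, h2, Matrix.smul_mulVec,
    Matrix.one_mulVec, dotProduct_smul, smul_eq_mul] at h
  simp only [SimpleGraph.neighborFinset_eq_filter, Finset.sum_filter]
  have h3 : f ⬝ᵥ f = ∑ m, f m ^ 2 := by simp [dotProduct, sq]
  rw [h3] at h
  linarith

theorem sum_norm_sq_sub_le_sSup_spectrum_lapMatrix {p : ℕ} (f : V → EuclideanSpace ℝ (Fin p)) :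
    (1 / 2) * ∑ m, ∑ l ∈ G.neighborFinset m, ‖f m - f l‖ ^ 2 ≤
      sSup (spectrum ℝ (G.lapMatrix ℝ)) * ∑ m, ‖f m‖ ^ 2 := by
  simp only [EuclideanSpace.real_norm_sq_eq, PiLp.sub_apply]
  have h := Finset.sum_le_sum fun (i : Fin p) (_ : i ∈ Finset.univ) =>
    sum_sq_sub_le_sSup_spectrum_lapMatrix G fun m => f m i
  rw [← Finset.mul_sum, ← Finset.mul_sum] at h
  have hR : ∑ m, ∑ i, f m i ^ 2 = ∑ i, ∑ m, f m i ^ 2 := Finset.sum_comm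
  have hL : ∑ m, ∑ l ∈ G.neighborFinset m, ∑ i, (f m i - f l i) ^ 2 =
      ∑ i, ∑ m, ∑ l ∈ G.neighborFinset m, (f m i - f l i) ^ 2 :=
    (Finset.sum_congr rfl fun m _ => Finset.sum_comm).trans Finset.sum_comm
  rwa [hR, hL]

end

variable [NormedAddCommGroup E] [InnerProductSpace ℝ E]

theorem sum_norm_sq_sub_step (x g : V → E) (α : ℝ) :
    ∑ m, ∑ l ∈ G.neighborFinset m, ‖(x m - α • g m) - (x l - α • g l)‖ ^ 2 =
      ∑ m, ∑ l ∈ G.neighborFinset m, ‖x m - x l‖ ^ 2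
        - 4 * α * ∑ m, inner ℝ (∑ l ∈ G.neighborFinset m, (x m - x l)) (g m)
        + α ^ 2 * ∑ m, ∑ l ∈ G.neighborFinset m, ‖g m - g l‖ ^ 2 := by
  have hterm : ∀ m l, ‖(x m - α • g m) - (x l - α • g l)‖ ^ 2 =
      ‖x m - x l‖ ^ 2 - 2 * α * inner ℝ (x m - x l) (g m)
        - 2 * α * inner ℝ (x l - x m) (g l) + α ^ 2 * ‖g m - g l‖ ^ 2 := by
    intro m l
    have h : (x m - α • g m) - (x l - α • g l) = (x m - x l) - α • (g m - g l) := by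
      module
    rw [h, norm_sub_sq_real, inner_smul_right, norm_smul, mul_pow, Real.norm_eq_abs, sq_abs,
      inner_sub_right, ← neg_sub (x m) (x l), inner_neg_left]
    ring
  simp only [sum_inner, hterm]
  simp only [Finset.sum_add_distrib, Finset.sum_sub_distrib, ← Finset.mul_sum]
  rw [sum_neighborFinset_swap G fun m l => inner ℝ (x l - x m) (g l)]
  ring

theorem Multiset.sum_map_norm_sq_sub_step (s : Multiset E) (a g : E) (α : ℝ) :
    (s.map fun y => ‖y - (a - α • g)‖ ^ 2).sum =
      (s.map fun y => ‖y - a‖ ^ 2).sum + 2 * α * inner ℝ (s.sum - (s.card : ℝ) • a) g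
        + α ^ 2 * (s.card * ‖g‖ ^ 2) := by
  induction s using Multiset.induction_on with
  | empty => simp
  | cons y s ih =>
    have h : y - (a - α • g) = (y - a) + α • g := by module
    simp only [Multiset.map_cons, Multiset.sum_cons, ih, Multiset.card_cons]
    rw [h, norm_add_sq_real, inner_smul_right, norm_smul, mul_pow, Real.norm_eq_abs, sq_abs]
    push_cast
    simp only [inner_sub_left, inner_add_left, inner_smul_left, add_smul]
    simp
    ring

end

section

variable {p K M : ℕ}

theorem muVec_weight_smul {ρ : ℝ} {G : SimpleGraph (Fin M)} [DecidableRel G.Adj]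
    {x : Fin M → Fin K → EuclideanSpace ℝ (Fin p)}
    {C : Fin M → Fin K → Multiset (EuclideanSpace ℝ (Fin p))} {m : Fin M} {k : Fin K}
    (hw : (1 / ρ) * ((C m k).card : ℝ) + (G.degree m : ℝ) ≠ 0) :
    ((1 / ρ) * ((C m k).card : ℝ) + (G.degree m : ℝ)) • muVec ρ G x C m k =
      (1 / ρ) • (C m k).sum + ∑ l ∈ G.neighborFinset m, x l k := by
  rw [muVec, smul_inv_smul₀ hw]

theorem costJ_step (ρ α : ℝ) (G : SimpleGraph (Fin M)) [DecidableRel G.Adj]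
    (x : Fin M → Fin K → EuclideanSpace ℝ (Fin p))
    (C : Fin M → Fin K → Multiset (EuclideanSpace ℝ (Fin p)))
    (hw : ∀ m k, (1 / ρ) * ((C m k).card : ℝ) + (G.degree m : ℝ) ≠ 0) :
    costJ ρ G (fun m k => x m k - α • (x m k - muVec ρ G x C m k)) C =
      costJ ρ G x C
        - 2 * α * ∑ k, ∑ m, ((1 / ρ) * ((C m k).card : ℝ) + (G.degree m : ℝ)) *
            ‖x m k - muVec ρ G x C m k‖ ^ 2
        + α ^ 2 * ∑ k, (∑ m, (1 / ρ) * ((C m k).card : ℝ) * ‖x m k - muVec ρ G x C m k‖ ^ 2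
            + (1 / 2) * ∑ m, ∑ l ∈ G.neighborFinset m,
              ‖(x m k - muVec ρ G x C m k) - (x l k - muVec ρ G x C l k)‖ ^ 2) := by
  set g : Fin M → Fin K → EuclideanSpace ℝ (Fin p) := fun m k => x m k - muVec ρ G x C m k
    with hg
  have hcomm : ∀ z : Fin M → Fin K → EuclideanSpace ℝ (Fin p), costJ ρ G z C =
      ∑ k, ((1 / ρ) * ∑ m, ((C m k).map fun y => ‖y - z m k‖ ^ 2).sum +
        (1 / 2) * ∑ m, ∑ l ∈ G.neighborFinset m, ‖z m k - z l k‖ ^ 2) := by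
    intro z
    simp only [costJ, Finset.sum_add_distrib, ← Finset.mul_sum]
    congr 2
    · exact Finset.sum_comm
    · rw [Finset.sum_comm]
      exact Finset.sum_congr rfl fun m _ => Finset.sum_comm
  change costJ ρ G (fun m k => x m k - α • g m k) C = _
  rw [hcomm, hcomm, Finset.mul_sum, Finset.mul_sum, ← Finset.sum_sub_distrib,
    ← Finset.sum_add_distrib]
  refine Finset.sum_congr rfl fun k _ => ?_
  change _ = _ - 2 * α * ∑ m, ((1 / ρ) * ((C m k).card : ℝ) + (G.degree m : ℝ)) * ‖g m k‖ ^ 2 +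
    α ^ 2 * (∑ m, (1 / ρ) * ((C m k).card : ℝ) * ‖g m k‖ ^ 2 + (1 / 2) *
      ∑ m, ∑ l ∈ G.neighborFinset m, ‖g m k - g l k‖ ^ 2)
  rw [sum_norm_sq_sub_step G (fun m => x m k) (fun m => g m k)]
  simp only [Multiset.sum_map_norm_sq_sub_step, Finset.sum_add_distrib, ← Finset.mul_sum]
  have hgrad : ∀ m, ((1 / ρ) * ((C m k).card : ℝ) + (G.degree m : ℝ)) * ‖g m k‖ ^ 2 =
      inner ℝ (∑ l ∈ G.neighborFinset m, (x m k - x l k)) (g m k)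
        - (1 / ρ) * inner ℝ ((C m k).sum - ((C m k).card : ℝ) • x m k) (g m k) := by
    intro m
    rw [← real_inner_self_eq_norm_sq, ← real_inner_smul_left, ← real_inner_smul_left,
      ← inner_sub_left]
    congr 1
    have := muVec_weight_smul (x := x) (hw m k)
    simp only [hg, smul_sub, this, Finset.sum_sub_distrib, Finset.sum_const,
      SimpleGraph.card_neighborFinset_eq_degree, mul_smul, add_smul, Nat.cast_smul_eq_nsmul]
    abel
  simp only [hgrad, Finset.sum_sub_distrib, ← Finset.mul_sum, mul_assoc]
  ring

theorem minDeg_le_degree (G : SimpleGraph (Fin M)) [DecidableRel G.Adj] (m : Fin M) :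
    minDeg G ≤ G.degree m :=
  Nat.sInf_le ⟨m, rfl⟩

theorem degree_le_lapLamMax (G : SimpleGraph (Fin M)) [DecidableRel G.Adj] (m : Fin M) :
    (G.degree m : ℝ) ≤ lapLamMax G :=
  degree_le_sSup_spectrum_lapMatrix G m

theorem card_le_Nstar {Dm : Fin M → Multiset (EuclideanSpace ℝ (Fin p))}
    {P : Fin K → Multiset (EuclideanSpace ℝ (Fin p))} {m : Fin M}
    (hP : IsKPartition (Dm m) P) (k : Fin K) : (P k).card ≤ Nstar Dm := by
  have h1 : (P k).card ≤ (Dm m).card := by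
    rw [← show ∑ k, P k = Dm m from hP]
    exact Multiset.card_le_card
      (Finset.single_le_sum (f := P) (fun _ _ => Multiset.zero_le _) (Finset.mem_univ k))
  exact h1.trans (Finset.le_sup (f := fun m => (Dm m).card) (Finset.mem_univ m))

section StepOK

variable {ρ α : ℝ} {G : SimpleGraph (Fin M)} [DecidableRel G.Adj]
  {Dm : Fin M → Multiset (EuclideanSpace ℝ (Fin p))}

theorem StepOK.minDeg_pos (hα : StepOK ρ α G Dm) (hρ : 0 < ρ) (m : Fin M) : 0 < minDeg G := by
  have hlam : 0 ≤ lapLamMax G := (Nat.cast_nonneg _).trans (degree_le_lapLamMax G m)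
  have h : (0 : ℝ) ≤ α * ((1 / ρ) * (Nstar Dm : ℝ) + lapLamMax G) := by
    have := hα.1
    positivity
  exact_mod_cast h.trans_lt hα.2

theorem StepOK.le_one (hα : StepOK ρ α G Dm) (hρ : 0 < ρ) (m : Fin M) : α ≤ 1 := by
  have hpos : (0 : ℝ) < minDeg G := by exact_mod_cast hα.minDeg_pos hρ m
  have h1 : (minDeg G : ℝ) ≤ lapLamMax G :=
    (Nat.cast_le.2 (minDeg_le_degree G m)).trans (degree_le_lapLamMax G m)
  have h2 : (0 : ℝ) ≤ (1 / ρ) * (Nstar Dm : ℝ) := by positivity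
  by_contra! h
  nlinarith [hα.2]

theorem StepOK.weight_pos (hα : StepOK ρ α G Dm) (hρ : 0 < ρ) (m : Fin M) (n : ℕ) :
    0 < (1 / ρ) * (n : ℝ) + (G.degree m : ℝ) := by
  have hpos : (0 : ℝ) < G.degree m := by
    exact_mod_cast (hα.minDeg_pos hρ m).trans_le (minDeg_le_degree G m)
  positivity

/-- A center update decreases the cost by at least a multiple of the squared residual. -/
theorem StepOK.costJ_step_le (hα : StepOK ρ α G Dm) (hρ : 0 < ρ)
    (x : Fin M → Fin K → EuclideanSpace ℝ (Fin p))
    {C : Fin M → Fin K → Multiset (EuclideanSpace ℝ (Fin p))}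
    (hC : ∀ m, IsKPartition (Dm m) (C m)) :
    costJ ρ G (fun m k => x m k - α • (x m k - muVec ρ G x C m k)) C ≤
      costJ ρ G x C - α * minDeg G * ∑ k, ∑ m, ‖x m k - muVec ρ G x C m k‖ ^ 2 := by
  rw [costJ_step ρ α G x C fun m k => (hα.weight_pos hρ m _).ne']
  rw [sub_add, Finset.mul_sum (a := 2 * α), Finset.mul_sum (a := α ^ 2),
    ← Finset.sum_sub_distrib, Finset.mul_sum (a := α * minDeg G)]
  refine sub_le_sub_left (Finset.sum_le_sum fun k _ => ?_) _
  have hspec := sum_norm_sq_sub_le_sSup_spectrum_lapMatrix G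
    fun m => x m k - muVec ρ G x C m k
  change _ ≤ lapLamMax G * _ at hspec
  set S := ∑ m, ‖x m k - muVec ρ G x C m k‖ ^ 2 with hS
  have hSnn : 0 ≤ S := by positivity
  set A := ∑ m, (1 / ρ) * ((C m k).card : ℝ) * ‖x m k - muVec ρ G x C m k‖ ^ 2 with hA
  have hAN : A ≤ (1 / ρ) * Nstar Dm * S := by
    rw [hA, hS, Finset.mul_sum]
    refine Finset.sum_le_sum fun m _ => ?_
    have := card_le_Nstar (hC m) k
    gcongr
  have hW : minDeg G * S ≤ ∑ m, ((1 / ρ) * ((C m k).card : ℝ) + (G.degree m : ℝ)) *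
      ‖x m k - muVec ρ G x C m k‖ ^ 2 := by
    rw [hS, Finset.mul_sum]
    refine Finset.sum_le_sum fun m _ => ?_
    have h1 : (minDeg G : ℝ) ≤ G.degree m := Nat.cast_le.2 (minDeg_le_degree G m)
    have h2 : (0 : ℝ) ≤ (1 / ρ) * ((C m k).card : ℝ) := by positivity
    gcongr
    linarith
  have hquad := mul_le_mul_of_nonneg_left (add_le_add hAN hspec) (sq_nonneg α)
  have hstep := mul_le_mul_of_nonneg_left hα.2.le (mul_nonneg hα.1.le hSnn)
  have hlin := mul_le_mul_of_nonneg_left hW (mul_nonneg zero_le_two hα.1.le)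
  linarith

end StepOK

theorem costQ_le_costJ {ρ : ℝ} (hρ : 0 < ρ) (G : SimpleGraph (Fin M)) [DecidableRel G.Adj]
    {Dm : Fin M → Multiset (EuclideanSpace ℝ (Fin p))}
    (x : Fin M → Fin K → EuclideanSpace ℝ (Fin p))
    {C : Fin M → Fin K → Multiset (EuclideanSpace ℝ (Fin p))}
    (hC : ∀ m, IsKPartition (Dm m) (C m)) : costQ ρ G Dm x ≤ costJ ρ G x C := by
  unfold costQ costJ
  gcongr with m _
  rw [← show ∑ k, C m k = Dm m from hC m, ← Multiset.coe_mapAddMonoidHom, map_sum,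
    Multiset.sum_sum]
  refine Finset.sum_le_sum fun k _ => Multiset.sum_map_le_sum_map _ _ fun y _ => ?_
  exact ciInf_le (Set.finite_range _).bddBelow k

theorem costQ_eq_costJ (ρ : ℝ) (G : SimpleGraph (Fin M)) [DecidableRel G.Adj]
    {Dm : Fin M → Multiset (EuclideanSpace ℝ (Fin p))}
    {x : Fin M → Fin K → EuclideanSpace ℝ (Fin p)}
    {C : Fin M → Fin K → Multiset (EuclideanSpace ℝ (Fin p))}
    (hC : InVoronoi Dm x C) : costQ ρ G Dm x = costJ ρ G x C := by
  unfold costQ costJ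
  congr 2
  refine Finset.sum_congr rfl fun m _ => ?_
  rw [← show ∑ k, C m k = Dm m from hC.1 m, ← Multiset.coe_mapAddMonoidHom, map_sum,
    Multiset.sum_sum]
  refine Finset.sum_congr rfl fun k _ => congrArg _ (Multiset.map_congr rfl fun y hy => ?_)
  have : Nonempty (Fin K) := ⟨k⟩
  refine le_antisymm (ciInf_le (Set.finite_range _).bddBelow k) (le_ciInf fun k' => ?_)
  gcongr
  exact hC.2 m k y hy k'

theorem costQ_nonneg {ρ : ℝ} (hρ : 0 < ρ) (G : SimpleGraph (Fin M)) [DecidableRel G.Adj]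
    (Dm : Fin M → Multiset (EuclideanSpace ℝ (Fin p)))
    (x : Fin M → Fin K → EuclideanSpace ℝ (Fin p)) : 0 ≤ costQ ρ G Dm x := by
  have h : 0 ≤ ∑ m, ((Dm m).map fun y => ⨅ k : Fin K, ‖y - x m k‖ ^ 2).sum :=
    Finset.sum_nonneg fun m _ => Multiset.sum_nonneg fun a ha => by
      obtain ⟨y, _, rfl⟩ := Multiset.mem_map.1 ha
      exact Real.iInf_nonneg fun k => sq_nonneg _
  unfold costQ
  positivity

/-- If a nonnegative sequence decreases by at least `r t` at each step, then `r` tends to zero. -/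
theorem tendsto_zero_of_add_le {V r : ℕ → ℝ} (hV : ∀ t, 0 ≤ V t) (hr : ∀ t, 0 ≤ r t)
    (h : ∀ t, V (t + 1) + r t ≤ V t) : Filter.Tendsto r Filter.atTop (nhds 0) := by
  refine (summable_of_sum_range_le (c := V 0) hr fun n => ?_).tendsto_atTop_zero
  have : ∑ i ∈ Finset.range n, r i ≤ V 0 - V n := by
    induction n with
    | zero => simp
    | succ n ih =>
      rw [Finset.sum_range_succ]
      linarith [h n]
  linarith [hV n]

theorem NKMeansSeq.tendsto_residual {ρ α : ℝ} {G : SimpleGraph (Fin M)} [DecidableRel G.Adj]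
    {Dm : Fin M → Multiset (EuclideanSpace ℝ (Fin p))}
    {x : ℕ → Fin M → Fin K → EuclideanSpace ℝ (Fin p)}
    {C : ℕ → Fin M → Fin K → Multiset (EuclideanSpace ℝ (Fin p))}
    (hseq : NKMeansSeq ρ α G Dm x C) (hρ : 0 < ρ) (hα : StepOK ρ α G Dm)
    (m : Fin M) (k : Fin K) :
    Filter.Tendsto (fun t => x t m k - muVec ρ G (x t) (C (t + 1)) m k)
      Filter.atTop (nhds 0) := by
  have hc : 0 < α * minDeg G := mul_pos hα.1 (by exact_mod_cast hα.minDeg_pos hρ m)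
  have hlim := tendsto_zero_of_add_le (V := fun t => costQ ρ G Dm (x t))
    (r := fun t => α * minDeg G * ∑ k, ∑ m, ‖x t m k - muVec ρ G (x t) (C (t + 1)) m k‖ ^ 2)
    (fun t => costQ_nonneg hρ G Dm (x t)) (fun t => by positivity) fun t => by
      obtain ⟨hP, hnear, hx⟩ := hseq.2 t
      have h1 := costQ_le_costJ hρ G (x (t + 1)) hP
      have h2 := hα.costJ_step_le hρ (x t) hP
      rw [← funext fun m => funext fun k => hx m k,
        ← costQ_eq_costJ ρ G (x := x t) ⟨hP, hnear⟩] at h2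
      linarith
  have hsq : Filter.Tendsto (fun t => ‖x t m k - muVec ρ G (x t) (C (t + 1)) m k‖ ^ 2)
      Filter.atTop (nhds 0) := by
    refine squeeze_zero (fun t => sq_nonneg _) (fun t => ?_)
      ((hlim.const_mul (α * minDeg G : ℝ)⁻¹).trans (by simp))
    rw [inv_mul_cancel_left₀ hc.ne']
    refine le_trans ?_ (Finset.single_le_sum (fun k _ => by positivity) (Finset.mem_univ k))
    exact Finset.single_le_sum
      (f := fun m => ‖x t m k - muVec ρ G (x t) (C (t + 1)) m k‖ ^ 2)
      (fun m _ => by positivity) (Finset.mem_univ m)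
  rw [tendsto_zero_iff_norm_tendsto_zero]
  simpa [Real.sqrt_sq] using hsq.sqrt

theorem continuous_muVec (ρ : ℝ) (G : SimpleGraph (Fin M)) [DecidableRel G.Adj]
    (C : Fin M → Fin K → Multiset (EuclideanSpace ℝ (Fin p))) (m : Fin M) (k : Fin K) :
    Continuous fun z : Fin M → Fin K → EuclideanSpace ℝ (Fin p) => muVec ρ G z C m k := by
  unfold muVec
  fun_prop

theorem finite_setOf_isKPartition (Dm : Fin M → Multiset (EuclideanSpace ℝ (Fin p))) (K : ℕ) :
    {C : Fin M → Fin K → Multiset (EuclideanSpace ℝ (Fin p)) |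
      ∀ m, IsKPartition (Dm m) (C m)}.Finite := by
  refine (Set.Finite.pi' fun m => Set.Finite.pi' fun _ : Fin K =>
    Multiset.finite_toSet (Dm m).powerset).subset fun C hC m k => Multiset.mem_powerset.2 ?_
  rw [← show ∑ k, C m k = Dm m from hC m]
  exact Finset.single_le_sum (f := C m) (fun _ _ => Multiset.zero_le _) (Finset.mem_univ k)

/-- Eventually, whenever the trajectory is close to a point `xb`, the clustering it uses makes
`xb` a fixed point of the center update. -/
theorem NKMeansSeq.eventually_isFixedCenters {ρ α : ℝ} {G : SimpleGraph (Fin M)}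
    [DecidableRel G.Adj] {Dm : Fin M → Multiset (EuclideanSpace ℝ (Fin p))}
    {x : ℕ → Fin M → Fin K → EuclideanSpace ℝ (Fin p)}
    {C : ℕ → Fin M → Fin K → Multiset (EuclideanSpace ℝ (Fin p))}
    (hseq : NKMeansSeq ρ α G Dm x C) (hρ : 0 < ρ) (hα : StepOK ρ α G Dm)
    (xb : Fin M → Fin K → EuclideanSpace ℝ (Fin p)) :
    ∀ᶠ q : ℕ × (Fin M → Fin K → EuclideanSpace ℝ (Fin p)) in Filter.atTop ×ˢ nhds xb,
      x q.1 = q.2 → IsFixedCenters ρ G xb (C (q.1 + 1)) := by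
  have hkey : ∀ᶠ q : ℕ × (Fin M → Fin K → EuclideanSpace ℝ (Fin p)) in
      Filter.atTop ×ˢ nhds xb, ∀ B ∈ {B : Fin M → Fin K → Multiset (EuclideanSpace ℝ (Fin p)) |
        ∀ m, IsKPartition (Dm m) (B m)},
        x q.1 = q.2 → C (q.1 + 1) = B → IsFixedCenters ρ G xb B := by
    rw [Filter.eventually_all_finite (finite_setOf_isKPartition Dm K)]
    intro B _
    by_cases hfix : IsFixedCenters ρ G xb B
    · exact Filter.Eventually.of_forall fun _ _ _ => hfix
    obtain ⟨m, k, hmk⟩ : ∃ m k, xb m k - muVec ρ G xb B m k ≠ 0 := by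
      by_contra! h
      refine hfix fun m k => ?_
      rw [← muVec_weight_smul (hα.weight_pos hρ m _).ne', ← sub_eq_zero.1 (h m k)]
    have hcont : Continuous fun z : Fin M → Fin K → EuclideanSpace ℝ (Fin p) =>
        z m k - muVec ρ G z B m k :=
      (continuous_apply_apply m k).sub (continuous_muVec ρ G B m k)
    have hδ := half_pos (norm_pos_iff.2 hmk)
    have h1 := hcont.norm.continuousAt.eventually_const_lt (half_lt_self (norm_pos_iff.2 hmk))
    have h2 := (tendsto_zero_iff_norm_tendsto_zero.1
      (hseq.tendsto_residual hρ hα m k)).eventually_lt_const hδ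
    filter_upwards [h2.prod_mk h1] with q hq hxq hCq
    obtain ⟨hq1, hq2⟩ := hq
    rw [hxq, hCq] at hq1
    exact absurd hq1 hq2.not_gt
  filter_upwards [hkey] with q hq hxq
  exact hq _ (fun m => (hseq.2 q.1).1 m) hxq rfl

/-- A center update with a clustering that fixes `xb` preserves coordinatewise balls
around `xb`. -/
theorem abs_step_sub_le {ρ α ε : ℝ} {G : SimpleGraph (Fin M)} [DecidableRel G.Adj]
    {x xb : Fin M → Fin K → EuclideanSpace ℝ (Fin p)}
    {C : Fin M → Fin K → Multiset (EuclideanSpace ℝ (Fin p))}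
    (hρ : 0 < ρ) (hα0 : 0 ≤ α) (hα1 : α ≤ 1) (hε : 0 ≤ ε) (hfix : IsFixedCenters ρ G xb C)
    {m : Fin M} {k : Fin K} (hw : 0 < (1 / ρ) * ((C m k).card : ℝ) + (G.degree m : ℝ))
    {i : Fin p} (hx : ∀ m, |x m k i - xb m k i| ≤ ε) :
    |(x m k - α • (x m k - muVec ρ G x C m k)) i - xb m k i| ≤ ε := by
  set w := (1 / ρ) * ((C m k).card : ℝ) + (G.degree m : ℝ) with hwdef
  have hdiff : w • (muVec ρ G x C m k - xb m k) =
      ∑ l ∈ G.neighborFinset m, (x l k - xb l k) := by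
    rw [smul_sub, muVec_weight_smul hw.ne', hfix m k, Finset.sum_sub_distrib]
    abel
  have hcoord : w * (muVec ρ G x C m k i - xb m k i) =
      ∑ l ∈ G.neighborFinset m, (x l k i - xb l k i) := by
    simpa using congrArg (fun v : EuclideanSpace ℝ (Fin p) => v i) hdiff
  have hmu : |muVec ρ G x C m k i - xb m k i| ≤ ε := by
    refine le_of_mul_le_mul_left ?_ hw
    calc w * |muVec ρ G x C m k i - xb m k i|
        = |∑ l ∈ G.neighborFinset m, (x l k i - xb l k i)| := by
          rw [← hcoord, abs_mul, abs_of_pos hw]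
      _ ≤ ∑ l ∈ G.neighborFinset m, |x l k i - xb l k i| := Finset.abs_sum_le_sum_abs _ _
      _ ≤ ∑ _l ∈ G.neighborFinset m, ε := Finset.sum_le_sum fun l _ => hx l
      _ = (G.degree m : ℝ) * ε := by simp
      _ ≤ w * ε := by
          have : 0 ≤ (1 / ρ) * ((C m k).card : ℝ) := by positivity
          gcongr
          linarith
  have hconv : (x m k - α • (x m k - muVec ρ G x C m k)) i - xb m k i =
      (1 - α) * (x m k i - xb m k i) + α * (muVec ρ G x C m k i - xb m k i) := by
    simp
    ring
  rw [hconv, abs_le]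
  have h1 := abs_le.1 (hx m)
  have h2 := abs_le.1 hmu
  constructor <;> nlinarith

theorem EuclideanSpace.norm_le_card_mul {v : EuclideanSpace ℝ (Fin p)} {ε : ℝ} (hε : 0 ≤ ε)
    (hv : ∀ i, |v i| ≤ ε) : ‖v‖ ≤ p * ε := by
  refine abs_le_of_sq_le_sq' ?_ (by positivity) |>.2
  rw [EuclideanSpace.real_norm_sq_eq]
  calc ∑ i, v i ^ 2 ≤ ∑ _i : Fin p, ε ^ 2 :=
        Finset.sum_le_sum fun i _ => sq_le_sq' (abs_le.1 (hv i)).1 (abs_le.1 (hv i)).2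
    _ = p * ε ^ 2 := by simp
    _ ≤ (p * ε) ^ 2 := by
        rw [mul_pow]
        gcongr
        exact_mod_cast Nat.le_self_pow two_ne_zero p

end

/-- Lemma 5, local stability of generalized minima: if `x̆` is a
generalized Lloyd's minimum, there is `ε̄ > 0` such that for each `ε ∈ (0, ε̄)` there
is a time `t_ε` with: if `‖x_{t'} − x̆‖_∞ ≤ ε` for some `t' ≥ t_ε`, then
`‖x_t − x̆‖_∞ ≤ ε` for all `t ≥ t'`.  (`‖·‖_∞` is the entrywise sup norm.) -/
theorem stmt14 {p K M : ℕ} (hK2 : 2 ≤ K)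
    (Dm : Fin M → Multiset (EuclideanSpace ℝ (Fin p)))
    (D : Multiset (EuclideanSpace ℝ (Fin p))) (hD : ∑ m, Dm m = D)
    (hdistinct : HasKDistinct K D)
    (G : SimpleGraph (Fin M)) [DecidableRel G.Adj] (hconn : G.Connected)
    (ρ α : ℝ) (hρ : 0 < ρ) (hα : StepOK ρ α G Dm)
    (x : ℕ → Fin M → Fin K → EuclideanSpace ℝ (Fin p))
    (C : ℕ → Fin M → Fin K → Multiset (EuclideanSpace ℝ (Fin p)))
    (hseq : NKMeansSeq ρ α G Dm x C)
    (xb : Fin M → Fin K → EuclideanSpace ℝ (Fin p))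
    (hgen : xb ∈ genM ρ G Dm K) :
    ∃ εbar : ℝ, 0 < εbar ∧ ∀ ε : ℝ, 0 < ε → ε < εbar → ∃ tε : ℕ, ∀ t' : ℕ, tε ≤ t' →
      (∀ (m : Fin M) (k : Fin K) (i : Fin p), |x t' m k i - xb m k i| ≤ ε) →
      ∀ t, t' ≤ t → ∀ (m : Fin M) (k : Fin K) (i : Fin p),
        |x t m k i - xb m k i| ≤ ε := by
  have hev := hseq.eventually_isFixedCenters hρ hα xb
  rw [Filter.eventually_prod_iff] at hev
  obtain ⟨pa, hpa, pb, hpb, hab⟩ := hev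
  obtain ⟨T, hT⟩ := Filter.eventually_atTop.1 hpa
  obtain ⟨r, hr, hball⟩ := Metric.eventually_nhds_iff.1 hpb
  refine ⟨r / (p + 1), by positivity, fun ε hε hεr => ⟨T, fun t' ht' hinit t ht => ?_⟩⟩
  induction t, ht using Nat.le_induction with
  | base => exact hinit
  | succ t ht ih =>
    have hdist : dist (x t) xb < r := by
      have hpr : p * ε < r := by
        rw [lt_div_iff₀ (by positivity)] at hεr
        linarith
      refine (dist_pi_lt_iff hr).2 fun m => (dist_pi_lt_iff hr).2 fun k => ?_
      rw [dist_eq_norm]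
      exact (EuclideanSpace.norm_le_card_mul hε.le fun i => by simpa using ih m k i).trans_lt hpr
    have hfix : IsFixedCenters ρ G xb (C (t + 1)) :=
      hab (hT t (ht'.trans ht)) (hball hdist) rfl
    intro m k i
    rw [(hseq.2 t).2.2 m k]
    exact abs_step_sub_le hρ hα.1.le (hα.le_one hρ m) hε.le hfix (hα.weight_pos hρ m _)
      fun m => ih m k i
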